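/- For each δ > 0 let x^δ ∈ E_γ^δ satisfy J^δ(x^δ) = max_{x ∈ E_γ^δ} J^δ(x). Then: (i) for every sequence {δ_n} of positive reals with δ_n → 0, the sequence {x^{δ_n}} contains a subsequence converging strongly in X to some x̄ ∈ E_γ; and (ii) every cluster point x̄ ∈ E_γ of {x^{δ_n}} is a minimizer of I, i.e., Φ(x̄) ≤ Φ(x) for all x ∈ E_γ. -/

import Mathlib

open MeasureTheory Metric Filter Topology

/-- The space `c₀` of real sequences converging to zero, with the supremum norm,
realized as the zero-at-infinity continuous maps on `ℕ`. -/
abbrev CZero : Type := ZeroAtInftyContinuousMap ℕ ℝ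

/-- The set `E_γ = {x : ∀ k, |x_k| ≤ γ_k}`. -/
def Egamma (γ : ℕ → ℝ) : Set CZero := {x | ∀ k, |x k| ≤ γ k}

/-- The set `E_γ^δ = {x : ∀ k, |x_k| ≤ max (γ_k - δ) 0}`. -/
def EgammaD (γ : ℕ → ℝ) (δ : ℝ) : Set CZero := {x | ∀ k, |x k| ≤ max (γ k - δ) 0}

/-- The law `ν_k` of `γ_k ξ_k` where `ξ_k` is uniform on `[-1,1]`: the uniform distribution
on `[-γ_k, γ_k]` if `γ_k > 0`, and the Dirac measure at `0` if `γ_k = 0`. -/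
noncomputable def nuMeas (γ : ℕ → ℝ) (k : ℕ) : Measure ℝ :=
  if γ k = 0 then Measure.dirac 0
  else (ENNReal.ofReal (2 * γ k))⁻¹ • volume.restrict (Set.Icc (-(γ k)) (γ k))

/-- `μ` is the law on `c₀` of the random series `ξ = Σ γ_k ξ_k e_k` with `ξ_k` i.i.d. uniform
on `[-1,1]` (equivalently, the pushforward under `t ↦ (γ_k t_k)_k` of the countable product of
uniform measures on `[-1,1]`), characterized by its finite-dimensional marginals: the
coordinates are independent with `x_k ∼ ν_k`. -/
def IsUniformSeriesLaw (γ : ℕ → ℝ) {m : MeasurableSpace CZero} (μ : Measure CZero) : Prop :=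
  ∀ (n : ℕ) (A : ℕ → Set ℝ), (∀ k, MeasurableSet (A k)) →
    μ {x : CZero | ∀ k < n, x k ∈ A k} = ∏ k ∈ Finset.range n, nuMeas γ k (A k)

/-- The maximal probability of an open ball of radius `δ` under `μ`. -/
noncomputable def maxBallProb {X : Type*} [PseudoMetricSpace X] [MeasurableSpace X]
    (μ : Measure X) (δ : ℝ) : ℝ :=
  ⨆ x : X, (μ (ball x δ)).toReal

/-- `xhat` is a strong mode of `μ` if `μ(B^δ(xhat))/M^δ → 1` as `δ → 0⁺`. -/
def IsStrongMode {X : Type*} [PseudoMetricSpace X] [MeasurableSpace X]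
    (μ : Measure X) (xhat : X) : Prop :=
  Tendsto (fun δ : ℝ => (μ (ball xhat δ)).toReal / maxBallProb μ δ) (𝓝[>] (0 : ℝ)) (𝓝 1)

/-- `xhat` is a generalized mode of `μ` if for every positive sequence `δ_n → 0` there is an
approximating sequence `w_n → xhat` with `μ(B^{δ_n}(w_n))/M^{δ_n} → 1`. -/
def IsGeneralizedMode {X : Type*} [PseudoMetricSpace X] [MeasurableSpace X]
    (μ : Measure X) (xhat : X) : Prop :=
  ∀ δ : ℕ → ℝ, (∀ n, 0 < δ n) → Tendsto δ atTop (𝓝 (0 : ℝ)) →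
    ∃ w : ℕ → X, Tendsto w atTop (𝓝 xhat) ∧
      Tendsto (fun n => (μ (ball (w n) (δ n))).toReal / maxBallProb μ (δ n)) atTop (𝓝 1)

/-- The normalization constant `Z = ∫ exp(-Φ(x)) dμ(x)`. -/
noncomputable def normConst {m : MeasurableSpace CZero} (μ : Measure CZero)
    (Φ : CZero → ℝ) : ENNReal :=
  ∫⁻ x, ENNReal.ofReal (Real.exp (-Φ x)) ∂μ

/-- The posterior measure `μ^y(A) = Z⁻¹ ∫_A exp(-Φ(x)) dμ(x)`. -/
noncomputable def posterior {m : MeasurableSpace CZero} (μ : Measure CZero)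
    (Φ : CZero → ℝ) : Measure CZero :=
  (normConst μ Φ)⁻¹ • μ.withDensity (fun x => ENNReal.ofReal (Real.exp (-Φ x)))

/-- `Φ` is Lipschitz continuous on every bounded subset of `c₀`. -/
def LipschitzOnBounded (Φ : CZero → ℝ) : Prop :=
  ∀ r : ℝ, 0 < r → ∃ L : ℝ, ∀ x₁ x₂ : CZero, ‖x₁‖ ≤ r → ‖x₂‖ ≤ r →
    |Φ x₁ - Φ x₂| ≤ L * ‖x₁ - x₂‖

namespace CZero

theorem tendsto_atTop (x : CZero) : Tendsto (fun k => x k) atTop (𝓝 (0 : ℝ)) := by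
  have h := ZeroAtInftyContinuousMapClass.zero_at_infty x
  rwa [cocompact_eq_cofinite, Nat.cofinite_eq_atTop] at h

/-- The sequence `x` tending to zero, as an element of `c₀`. -/
def ofTendsto (x : ℕ → ℝ) (hx : Tendsto x atTop (𝓝 0)) : CZero where
  toFun := x
  continuous_toFun := continuous_of_discreteTopology
  zero_at_infty' := by rwa [cocompact_eq_cofinite, Nat.cofinite_eq_atTop]

@[simp]
theorem ofTendsto_apply (x : ℕ → ℝ) (hx : Tendsto x atTop (𝓝 0)) (k : ℕ) :
    ofTendsto x hx k = x k := rfl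

theorem abs_apply_le_norm (x : CZero) (k : ℕ) : |x k| ≤ ‖x‖ :=
  x.toBCF.norm_coe_le_norm k

theorem norm_le {x : CZero} {C : ℝ} (hC : 0 ≤ C) (h : ∀ k, |x k| ≤ C) : ‖x‖ ≤ C :=
  (BoundedContinuousFunction.norm_le (f := x.toBCF) hC).2 h

/-- The supremum defining the norm on `c₀` is attained, so strict coordinate bounds suffice. -/
theorem norm_lt {x : CZero} {δ : ℝ} (hδ : 0 < δ) (h : ∀ k, |x k| < δ) : ‖x‖ < δ := by
  obtain ⟨N, hN⟩ := eventually_atTop.1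
    ((tendsto_atTop x).abs.eventually (gt_mem_nhds (by simpa using half_pos hδ : |(0 : ℝ)| < δ / 2)))
  obtain ⟨C, hCδ, hC⟩ : ∃ C < δ, ∀ k < N, |x k| ≤ C := by
    clear hN
    induction N with
    | zero => exact ⟨0, hδ, by simp⟩
    | succ n ih =>
      obtain ⟨C, hCδ, hC⟩ := ih
      refine ⟨max C |x n|, max_lt hCδ (h n), fun k hk => ?_⟩
      rcases Nat.lt_succ_iff_lt_or_eq.1 hk with hk | rfl
      · exact (hC k hk).trans (le_max_left _ _)
      · exact le_max_right _ _
  refine (norm_le (C := max C (δ / 2)) (le_max_of_le_right (half_pos hδ).le) fun k => ?_).trans_lt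
    (max_lt hCδ (half_lt_self hδ))
  rcases lt_or_ge k N with hk | hk
  · exact (hC k hk).trans (le_max_left _ _)
  · exact (hN k hk).le.trans (le_max_right _ _)

theorem continuous_eval (k : ℕ) : Continuous fun x : CZero => x k :=
  (LipschitzWith.of_dist_le_mul (K := 1) fun x y => by
    simpa [Real.dist_eq, dist_eq_norm] using abs_apply_le_norm (x - y) k).continuous

theorem ball_eq {δ : ℝ} (hδ : 0 < δ) (z : CZero) :
    ball z δ = {x : CZero | ∀ k, x k ∈ Set.Ioo (z k - δ) (z k + δ)} := by
  ext x
  simp only [mem_ball, dist_eq_norm, Set.mem_ofPred_eq, Set.mem_Ioo]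
  constructor
  · intro h k
    have := abs_lt.1 ((abs_apply_le_norm (x - z) k).trans_lt h)
    simp only [ZeroAtInftyContinuousMap.sub_apply] at this
    constructor <;> linarith
  · intro h
    refine norm_lt hδ fun k => abs_lt.2 ?_
    simp only [ZeroAtInftyContinuousMap.sub_apply]
    constructor <;> linarith [(h k).1, (h k).2]

end CZero

theorem norm_le_of_mem_Egamma {γ : ℕ → ℝ} {R : ℝ} (hR0 : 0 ≤ R) (hR : ∀ k, γ k ≤ R) {x : CZero}
    (hx : x ∈ Egamma γ) : ‖x‖ ≤ R :=
  CZero.norm_le hR0 fun k => (hx k).trans (hR k)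

theorem EgammaD_subset_Egamma {γ : ℕ → ℝ} (hγ0 : ∀ k, 0 ≤ γ k) {δ : ℝ} (hδ : 0 < δ) :
    EgammaD γ δ ⊆ Egamma γ :=
  fun _ hx k => (hx k).trans (max_le (by linarith) (hγ0 k))

/-- `E_γ` is sequentially compact in `c₀`. -/
theorem isSeqCompact_Egamma {γ : ℕ → ℝ} (hγ : Tendsto γ atTop (𝓝 (0 : ℝ))) :
    IsSeqCompact (Egamma γ) := by
  intro x hx
  have hK : IsCompact (Set.univ.pi fun k => Set.Icc (-γ k) (γ k)) :=
    isCompact_univ_pi fun k => isCompact_Icc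
  obtain ⟨t, ht, φ, hφ, hlim⟩ := hK.tendsto_subseq (x := fun n k => x n k)
    (fun n k _ => abs_le.1 (hx n k))
  have htγ : ∀ k, |t k| ≤ γ k := fun k => abs_le.2 (ht k trivial)
  refine ⟨CZero.ofTendsto t (squeeze_zero_norm htγ hγ), htγ, φ, hφ, Metric.tendsto_nhds.2 ?_⟩
  intro ε hε
  obtain ⟨N, hN⟩ := eventually_atTop.1 (hγ.eventually (gt_mem_nhds (by positivity : 0 < ε / 4)))
  have hcoord : ∀ᶠ n in atTop, ∀ k ∈ Finset.range N, |x (φ n) k - t k| < ε / 2 := by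
    refine (eventually_all_finset _).2 fun k _ => ?_
    exact Metric.tendsto_nhds.1 (tendsto_pi_nhds.1 hlim k) (ε / 2) (half_pos hε)
  filter_upwards [hcoord] with n hn
  rw [dist_eq_norm]
  refine (CZero.norm_le (half_pos hε).le fun k => ?_).trans_lt (half_lt_self hε)
  simp only [ZeroAtInftyContinuousMap.sub_apply, CZero.ofTendsto_apply, Function.comp_apply]
  rcases lt_or_ge k N with hk | hk
  · exact (hn k (Finset.mem_range.2 hk)).le
  · linarith [abs_sub (x (φ n) k) (t k), hx (φ n) k, htγ k, hN k hk]

/-- Every point of `E_γ` lies within distance `δ` of `E_γ^δ`. -/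
theorem exists_mem_EgammaD_norm_sub_le {γ : ℕ → ℝ} (hγ : Tendsto γ atTop (𝓝 (0 : ℝ)))
    {δ : ℝ} (hδ : 0 < δ) {z : CZero} (hz : z ∈ Egamma γ) :
    ∃ w ∈ EgammaD γ δ, ‖w - z‖ ≤ δ := by
  let t : ℕ → ℝ := fun k => max (-max (γ k - δ) 0) (min (z k) (max (γ k - δ) 0))
  have ht : ∀ k, |t k| ≤ max (γ k - δ) 0 := fun k =>
    abs_le.2 ⟨le_max_left _ _,
      max_le (by linarith [le_max_right (γ k - δ) 0]) (min_le_right _ _)⟩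
  have htγ : ∀ k, ‖t k‖ ≤ γ k := fun k =>
    (ht k).trans (max_le (by linarith) ((abs_nonneg _).trans (hz k)))
  refine ⟨CZero.ofTendsto t (squeeze_zero_norm htγ hγ), ht, CZero.norm_le hδ.le fun k => ?_⟩
  simp only [ZeroAtInftyContinuousMap.sub_apply, CZero.ofTendsto_apply, t]
  have := abs_le.1 (hz k)
  rw [abs_le]
  constructor <;> grind

/-- The mass that the uniform distribution on `[-g, g]` gives to an interval of radius `δ`
centred at a point of `[-(g - δ), g - δ]` (or at `0` when `g ≤ δ`). -/
noncomputable def uniformIntervalMass (δ g : ℝ) : ENNReal :=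
  if g ≤ δ then 1 else (ENNReal.ofReal (2 * g))⁻¹ * ENNReal.ofReal (2 * δ)

theorem uniformIntervalMass_ne_zero {δ g : ℝ} (hδ : 0 < δ) : uniformIntervalMass δ g ≠ 0 := by
  unfold uniformIntervalMass
  split_ifs
  · exact one_ne_zero
  · exact mul_ne_zero (ENNReal.inv_ne_zero.2 ENNReal.ofReal_ne_top)
      (ENNReal.ofReal_pos.2 (by positivity)).ne'

theorem nuMeas_Ioo {γ : ℕ → ℝ} {k : ℕ} (hγ0 : 0 ≤ γ k) {δ z : ℝ} (hδ : 0 < δ)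
    (hz : |z| ≤ max (γ k - δ) 0) :
    nuMeas γ k (Set.Ioo (z - δ) (z + δ)) = uniformIntervalMass δ (γ k) := by
  unfold nuMeas uniformIntervalMass
  split_ifs with h0 hle hle
  · have hz0 : z = 0 := by
      rw [max_eq_right (by linarith)] at hz
      exact abs_nonpos_iff.1 hz
    rw [Measure.dirac_apply' _ measurableSet_Ioo, Set.indicator_of_mem (by simp [hz0, hδ])]
    rfl
  · linarith
  · have hz0 : z = 0 := by
      rw [max_eq_right (by linarith)] at hz
      exact abs_nonpos_iff.1 hz
    have hpos : 0 < γ k := lt_of_le_of_ne hγ0 (Ne.symm h0)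
    have hvol : volume (Set.Ioo (z - δ) (z + δ) ∩ Set.Icc (-γ k) (γ k))
        = ENNReal.ofReal (2 * γ k) := by
      apply le_antisymm
      · refine (measure_mono Set.inter_subset_right).trans ?_
        rw [Real.volume_Icc]
        exact ENNReal.ofReal_le_ofReal (by linarith)
      · calc ENNReal.ofReal (2 * γ k) = volume (Set.Ioo (-γ k) (γ k)) := by
              rw [Real.volume_Ioo]; congr 1; ring
          _ ≤ volume (Set.Ioo (z - δ) (z + δ) ∩ Set.Icc (-γ k) (γ k)) := measure_mono fun x hx =>
              ⟨⟨by linarith [hx.1], by linarith [hx.2]⟩, Set.Ioo_subset_Icc_self hx⟩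
    rw [Measure.smul_apply, Measure.restrict_apply measurableSet_Ioo, hvol, smul_eq_mul]
    exact ENNReal.inv_mul_cancel (ENNReal.ofReal_pos.2 (by positivity)).ne' ENNReal.ofReal_ne_top
  · rw [max_eq_left (by linarith)] at hz
    have hz' := abs_le.1 hz
    have hsub : Set.Ioo (z - δ) (z + δ) ⊆ Set.Icc (-γ k) (γ k) := fun x hx =>
      ⟨by linarith [hx.1], by linarith [hx.2]⟩
    rw [Measure.smul_apply, Measure.restrict_apply measurableSet_Ioo,
      Set.inter_eq_left.2 hsub, smul_eq_mul, Real.volume_Ioo]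
    congr 2
    ring

/-- All balls of radius `δ` centred in `E_γ^δ` have the same positive prior mass. -/
theorem exists_measure_ball_eq {γ : ℕ → ℝ} (hγ0 : ∀ k, 0 ≤ γ k)
    (hγ : Tendsto γ atTop (𝓝 (0 : ℝ))) [MeasurableSpace CZero] [BorelSpace CZero]
    {μ : Measure CZero} [IsProbabilityMeasure μ] (hμ : IsUniformSeriesLaw γ μ)
    {δ : ℝ} (hδ : 0 < δ) :
    ∃ c : ENNReal, c ≠ 0 ∧ ∀ z ∈ EgammaD γ δ, μ (ball z δ) = c := by
  obtain ⟨N, hN⟩ := eventually_atTop.1 (hγ.eventually (gt_mem_nhds hδ))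
  refine ⟨∏ k ∈ Finset.range N, uniformIntervalMass δ (γ k),
    Finset.prod_ne_zero_iff.2 fun k _ => uniformIntervalMass_ne_zero hδ, fun z hz => ?_⟩
  let S : ℕ → Set CZero := fun n => {x | ∀ k < n, x k ∈ Set.Ioo (z k - δ) (z k + δ)}
  have hS : ball z δ = ⋂ n, S n := by
    rw [CZero.ball_eq hδ]
    ext x
    simp only [Set.mem_ofPred_eq, Set.mem_iInter, S]
    exact ⟨fun h n k _ => h k, fun h k => h (k + 1) k k.lt_succ_self⟩
  have hmeas : ∀ n, MeasurableSet (S n) := fun n => by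
    have : S n = ⋂ k, ⋂ (_ : k < n), (fun x : CZero => x k) ⁻¹' Set.Ioo (z k - δ) (z k + δ) := by
      ext x; simp [S]
    rw [this]
    exact MeasurableSet.iInter fun k => MeasurableSet.iInter fun _ =>
      (CZero.continuous_eval k).measurable measurableSet_Ioo
  have hanti : Antitone S := fun m n hmn x hx k hk => hx k (hk.trans_le hmn)
  have hlim := tendsto_measure_iInter_atTop (μ := μ) (fun n => (hmeas n).nullMeasurableSet) hanti
    ⟨0, measure_ne_top μ _⟩
  rw [← hS] at hlim
  refine tendsto_nhds_unique hlim (tendsto_const_nhds.congr' ?_)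
  filter_upwards [eventually_ge_atTop N] with n hn
  have hSn : μ (S n) = ∏ k ∈ Finset.range n, uniformIntervalMass δ (γ k) := by
    rw [hμ n (fun k => Set.Ioo (z k - δ) (z k + δ)) fun k => measurableSet_Ioo]
    exact Finset.prod_congr rfl fun k _ => nuMeas_Ioo (hγ0 k) hδ (hz k)
  rw [Function.comp_apply, hSn]
  refine Finset.prod_subset (Finset.range_mono hn) fun k _ hk => ?_
  exact if_pos (hN k (by simpa using hk)).le

theorem posterior_ball [MeasurableSpace CZero] [BorelSpace CZero]
    (μ : Measure CZero) (Φ : CZero → ℝ) (z : CZero) (δ : ℝ) :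
    posterior μ Φ (ball z δ)
      = (normConst μ Φ)⁻¹ * ∫⁻ x in ball z δ, ENNReal.ofReal (Real.exp (-Φ x)) ∂μ := by
  rw [posterior, Measure.smul_apply, withDensity_apply _ measurableSet_ball, smul_eq_mul]

/-- If `Φ` oscillates by at most `η` around the centres of two balls of equal prior mass,
then comparing their posterior masses compares `Φ` at the centres up to `2 * η`. -/
theorem le_add_of_posterior_ball_le [MeasurableSpace CZero] [BorelSpace CZero]
    {μ : Measure CZero} [IsFiniteMeasure μ] {Φ : CZero → ℝ}
    (hZ0 : normConst μ Φ ≠ 0) (hZtop : normConst μ Φ ≠ ⊤) {z w : CZero} {δ η : ℝ}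
    (hzw : μ (ball z δ) = μ (ball w δ)) (hw : μ (ball w δ) ≠ 0)
    (hΦz : ∀ x ∈ ball z δ, |Φ x - Φ z| ≤ η) (hΦw : ∀ x ∈ ball w δ, |Φ x - Φ w| ≤ η)
    (h : posterior μ Φ (ball z δ) ≤ posterior μ Φ (ball w δ)) :
    Φ w ≤ Φ z + 2 * η := by
  rw [posterior_ball, posterior_ball,
    ENNReal.mul_le_mul_iff_right (ENNReal.inv_ne_zero.2 hZtop) (ENNReal.inv_ne_top.2 hZ0)] at h
  have hlow : ENNReal.ofReal (Real.exp (-Φ z - η)) * μ (ball z δ)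
      ≤ ∫⁻ x in ball z δ, ENNReal.ofReal (Real.exp (-Φ x)) ∂μ := by
    rw [← setLIntegral_const]
    refine setLIntegral_mono' measurableSet_ball fun x hx => ?_
    gcongr
    linarith [(abs_le.1 (hΦz x hx)).2]
  have hupp : ∫⁻ x in ball w δ, ENNReal.ofReal (Real.exp (-Φ x)) ∂μ
      ≤ ENNReal.ofReal (Real.exp (-Φ w + η)) * μ (ball w δ) := by
    rw [← setLIntegral_const]
    refine setLIntegral_mono' measurableSet_ball fun x hx => ?_
    gcongr
    linarith [(abs_le.1 (hΦw x hx)).1]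
  have hcmp := (hlow.trans h).trans hupp
  rw [hzw, ENNReal.mul_le_mul_iff_left hw (measure_ne_top μ _),
    ENNReal.ofReal_le_ofReal_iff (Real.exp_pos _).le, Real.exp_le_exp] at hcmp
  linarith

theorem LipschitzOnBounded.continuous {Φ : CZero → ℝ} (hΦ : LipschitzOnBounded Φ) :
    Continuous Φ := by
  refine continuous_iff_continuousAt.2 fun x => ?_
  obtain ⟨L, hL⟩ := hΦ (‖x‖ + 1) (by positivity)
  have hlim : Tendsto (fun y => L * ‖y - x‖) (𝓝 x) (𝓝 0) := by
    have : Continuous fun y => L * ‖y - x‖ := by fun_prop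
    simpa using this.tendsto x
  refine tendsto_iff_dist_tendsto_zero.2 (squeeze_zero' (Eventually.of_forall fun _ => dist_nonneg)
    ?_ hlim)
  filter_upwards [ball_mem_nhds x one_pos] with y hy
  rw [Real.dist_eq]
  refine hL y x ?_ (by linarith)
  rw [mem_ball, dist_eq_norm] at hy
  linarith [norm_le_norm_add_norm_sub' y x]

theorem posterior_maximizers_cluster_at_minimizers (γ : ℕ → ℝ) (hγ0 : ∀ k, 0 ≤ γ k)
    (hγ : Tendsto γ atTop (𝓝 (0 : ℝ)))
    [MeasurableSpace CZero] [BorelSpace CZero]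
    (μ : Measure CZero) [IsProbabilityMeasure μ] (hμ : IsUniformSeriesLaw γ μ)
    (Φ : CZero → ℝ) (hΦ : LipschitzOnBounded Φ)
    (hZ0 : normConst μ Φ ≠ 0) (hZtop : normConst μ Φ ≠ ⊤)
    (xsel : ℝ → CZero)
    (hselmem : ∀ δ : ℝ, 0 < δ → xsel δ ∈ EgammaD γ δ)
    (hselmax : ∀ δ : ℝ, 0 < δ → ∀ z ∈ EgammaD γ δ,
      (posterior μ Φ) (ball z δ) ≤ (posterior μ Φ) (ball (xsel δ) δ)) :
    ∀ δs : ℕ → ℝ, (∀ n, 0 < δs n) → Tendsto δs atTop (𝓝 (0 : ℝ)) →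
      (∃ φ : ℕ → ℕ, StrictMono φ ∧ ∃ xbar ∈ Egamma γ,
        Tendsto (fun n => xsel (δs (φ n))) atTop (𝓝 xbar)) ∧
      (∀ xbar ∈ Egamma γ, MapClusterPt xbar atTop (fun n => xsel (δs n)) →
        ∀ z ∈ Egamma γ, Φ xbar ≤ Φ z) := by
  have hcompact := isSeqCompact_Egamma hγ
  intro δs hδs hδlim
  have hmem : ∀ n, xsel (δs n) ∈ Egamma γ := fun n =>
    EgammaD_subset_Egamma hγ0 (hδs n) (hselmem _ (hδs n))
  refine ⟨?_, fun xbar _ hclus z hz => ?_⟩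
  · obtain ⟨xbar, hxbar, φ, hφ, hlim⟩ := hcompact hmem
    exact ⟨φ, hφ, xbar, hxbar, hlim⟩
  obtain ⟨R, hR⟩ := hγ.bddAbove_range
  have hR : ∀ k, γ k ≤ R := fun k => hR ⟨k, rfl⟩
  have hR0 : 0 ≤ R := (hγ0 0).trans (hR 0)
  obtain ⟨L, hL⟩ := hΦ (R + 1) (by positivity)
  have hosc : ∀ w ∈ Egamma γ, ∀ δ ≤ 1, ∀ x : CZero, ‖x - w‖ ≤ δ →
      |Φ x - Φ w| ≤ |L| * δ := fun w hw δ hδ1 x hx => by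
    have hwR := norm_le_of_mem_Egamma hR0 hR hw
    have hxR : ‖x‖ ≤ R + 1 := by linarith [norm_le_norm_add_norm_sub' x w]
    exact (hL x w hxR (by linarith)).trans
      (mul_le_mul (le_abs_self L) hx (norm_nonneg _) (abs_nonneg L))
  have hnear : ∀ δ, 0 < δ → δ ≤ 1 → Φ (xsel δ) ≤ Φ z + 3 * (|L| * δ) := fun δ hδ hδ1 => by
    obtain ⟨w, hw, hwz⟩ := exists_mem_EgammaD_norm_sub_le hγ hδ hz
    obtain ⟨c, hc0, hc⟩ := exists_measure_ball_eq hγ0 hγ hμ hδ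
    have hsub := EgammaD_subset_Egamma hγ0 hδ
    have hball : ∀ v ∈ EgammaD γ δ, ∀ x ∈ ball v δ, |Φ x - Φ v| ≤ |L| * δ :=
      fun v hv x hx => hosc v (hsub hv) δ hδ1 x (by simpa [dist_eq_norm] using (mem_ball.1 hx).le)
    have hcmp := le_add_of_posterior_ball_le hZ0 hZtop
      ((hc w hw).trans (hc _ (hselmem δ hδ)).symm) (by rwa [hc _ (hselmem δ hδ)])
      (hball w hw) (hball _ (hselmem δ hδ)) (hselmax δ hδ w hw)
    linarith [(abs_le.1 (hosc z hz δ hδ1 w hwz)).2]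
  obtain ⟨ψ, hψ, hψlim⟩ := hclus.tendsto_subseq
  have hδψ : Tendsto (fun n => δs (ψ n)) atTop (𝓝 0) := hδlim.comp hψ.tendsto_atTop
  have hrhs : Tendsto (fun n => Φ z + 3 * (|L| * δs (ψ n))) atTop (𝓝 (Φ z)) := by
    simpa using ((hδψ.const_mul |L|).const_mul 3).const_add (Φ z)
  refine le_of_tendsto_of_tendsto ((hΦ.continuous.tendsto xbar).comp hψlim) hrhs ?_
  filter_upwards [hδψ.eventually (gt_mem_nhds one_pos)] with n hn
  exact hnear _ (hδs _) hn.le
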